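/- Sears' ${}_3\phi_2$ to ${}_5\phi_4$ transformation (terminating case $a = q^{-n}$): Let $n \ge 0$ be an integer and let $q, b, c, x$ be nonzero complex numbers such that all factors occurring in denominators below are nonzero. Then $\sum_{k=0}^{n} \frac{(q^{-n};q)_k (b;q)_k (c;q)_k}{(q;q)_k (q^{1-n}/b;q)_k (q^{1-n}/c;q)_k} \left(\frac{q^{1-n}x}{bc}\right)^{k} = (q^{-n}x;q)_n \sum_{k=0}^{n} \frac{(q^{-n};q)_{2k} \, (q^{1-n}/(bc);q)_k \, q^k}{(q;q)_k (q^{1-n}/b;q)_k (q^{1-n}/c;q)_k (q^{-n}x;q)_k (q/x;q)_k}$. (Here $(q^{-n};q)_{2k}$ encodes the four well-poised numerator parameters $a^{1/2}, -a^{1/2}, (aq)^{1/2}, -(aq)^{1/2}$ with $a = q^{-n}$, and $(q^{-n}x;q)_n = (ax;q)_\infty/(x;q)_\infty$ at $a = q^{-n}$.) -/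

import Mathlib

set_option autoImplicit false

/-- The q-shifted factorial `(a;q)_n = ∏_{j=0}^{n-1} (1 - a q^j)`. -/
noncomputable def qPoch (q a : ℂ) (n : ℕ) : ℂ := ∏ j ∈ Finset.range n, (1 - a * q ^ j)

section QPoch

variable {q : ℂ}

theorem qPoch_zero (a : ℂ) : qPoch q a 0 = 1 := by simp [qPoch]

theorem qPoch_succ (a : ℂ) (n : ℕ) : qPoch q a (n + 1) = qPoch q a n * (1 - a * q ^ n) :=
  Finset.prod_range_succ _ _

theorem qPoch_add (a : ℂ) (m n : ℕ) :
    qPoch q a (m + n) = qPoch q a m * qPoch q (a * q ^ m) n := by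
  simp only [qPoch, Finset.prod_range_add, pow_add, mul_assoc]

theorem qPoch_succ' (a : ℂ) (n : ℕ) :
    qPoch q a (n + 1) = (1 - a) * qPoch q (a * q) n := by
  rw [add_comm, qPoch_add]
  simp [qPoch]

theorem qPoch_ne_zero_of_le {a : ℂ} {m n : ℕ} (hmn : m ≤ n) (h : qPoch q a n ≠ 0) :
    qPoch q a m ≠ 0 := by
  obtain ⟨k, rfl⟩ := Nat.exists_eq_add_of_le hmn
  rw [qPoch_add] at h
  exact left_ne_zero_of_mul h

theorem qPoch_zpow_neg_eq_zero (hq : q ≠ 0) {j k : ℕ} (hjk : j < k) :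
    qPoch q (q ^ (-(j : ℤ))) k = 0 :=
  Finset.prod_eq_zero (Finset.mem_range.2 hjk) (by simp [hq])

/-- Reversal of the order of the factors. -/
theorem qPoch_reverse (hq : q ≠ 0) {a : ℂ} (ha : a ≠ 0) (n : ℕ) :
    qPoch q a n = (-a) ^ n * q ^ n.choose 2 * qPoch q (q ^ (1 - (n : ℤ)) / a) n := by
  induction n with
  | zero => simp [qPoch]
  | succ n ih =>
    have h1 : q ^ (1 - ((n + 1 : ℕ) : ℤ)) / a * q = q ^ (1 - (n : ℤ)) / a := by
      rw [div_mul_eq_mul_div, ← zpow_add_one₀ hq]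
      congr 2
      push_cast
      ring
    have h2 : q ^ (1 - ((n + 1 : ℕ) : ℤ)) = (q ^ n)⁻¹ := by
      rw [← zpow_natCast, ← zpow_neg]
      congr 1
      push_cast
      ring
    rw [qPoch_succ, qPoch_succ', h1, ih, h2, Nat.choose_succ_succ' n 1, Nat.choose_one_right]
    field_simp
    ring

/-- The terminating `q`-binomial theorem. -/
theorem sum_qPoch_div_qPoch_mul_pow (hq : q ≠ 0) (n : ℕ) (z : ℂ) (h : qPoch q q n ≠ 0) :
    ∑ m ∈ Finset.range (n + 1), qPoch q (q ^ (-(n : ℤ))) m / qPoch q q m * z ^ m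
      = qPoch q (q ^ (-(n : ℤ)) * z) n := by
  induction n with
  | zero => simp [qPoch]
  | succ n ih =>
    have hs : q ^ (-((n + 1 : ℕ) : ℤ)) * q = q ^ (-(n : ℤ)) := by
      rw [← zpow_add_one₀ hq]
      congr 1
      push_cast
      ring
    have hz : qPoch q (q ^ (-(n : ℤ))) (n + 1) = 0 := qPoch_zpow_neg_eq_zero hq (Nat.lt_succ_self n)
    rw [qPoch_succ', mul_right_comm, hs, ← ih (qPoch_ne_zero_of_le n.le_succ h), sub_mul, one_mul]
    have e : ∑ m ∈ Finset.range (n + 1), qPoch q (q ^ (-(n : ℤ))) m / qPoch q q m * z ^ m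
        = ∑ m ∈ Finset.range (n + 1),
            qPoch q (q ^ (-(n : ℤ))) (m + 1) / qPoch q q (m + 1) * z ^ (m + 1) + 1 := by
      have := Finset.sum_range_succ'
        (fun m => qPoch q (q ^ (-(n : ℤ))) m / qPoch q q m * z ^ m) (n + 1)
      rw [Finset.sum_range_succ, hz] at this
      simpa [qPoch_zero] using this
    rw [Finset.sum_range_succ' _ (n + 1), qPoch_zero, qPoch_zero, pow_zero, div_one, mul_one]
    refine Eq.trans ?_ (congrArg (fun t => t - q ^ (-((n + 1 : ℕ) : ℤ)) * z *
      ∑ m ∈ Finset.range (n + 1), qPoch q (q ^ (-(n : ℤ))) m / qPoch q q m * z ^ m) e.symm)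
    rw [add_sub_right_comm, Finset.mul_sum, ← Finset.sum_sub_distrib]
    congr 1
    refine Finset.sum_congr rfl fun m hm => ?_
    have h1 := qPoch_ne_zero_of_le (Nat.succ_le_of_lt (Finset.mem_range.1 hm)) h
    rw [Nat.succ_eq_add_one, qPoch_succ] at h1
    rw [qPoch_succ', hs, qPoch_succ q, qPoch_succ (q ^ (-(n : ℤ))), ← hs]
    have h2 := left_ne_zero_of_mul h1
    have h3 := right_ne_zero_of_mul h1
    field_simp
    ring

/-- The telescoping partial sums behind the recurrence in the length of the Saalschütz sum. -/
theorem qPoch_saalschutz_partial_sum {A B C D Q : ℂ} (hq : q ≠ 0) (hA : A ≠ 0) (hB : B ≠ 0)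
    (hC : C ≠ 0) (hQ : Q ≠ 0) (hD : D * C * Q = A * B * q) (m : ℕ) (h1 : qPoch q q m ≠ 0)
    (h2 : qPoch q C m ≠ 0) (h3 : qPoch q (D / q) (m + 1) ≠ 0) :
    ∑ k ∈ Finset.range (m + 1),
      (qPoch q (Q⁻¹ / q) k * qPoch q A k * qPoch q B k * q ^ k /
          (qPoch q q k * qPoch q C k * qPoch q (D / q) k) *
          ((1 - C * Q) * (1 - C / (A * B) * Q)) -
        qPoch q Q⁻¹ k * qPoch q A k * qPoch q B k * q ^ k /
          (qPoch q q k * qPoch q C k * qPoch q D k) *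
          ((1 - C / A * Q) * (1 - C / B * Q)))
      = -(C * Q / (A * B)) * (qPoch q Q⁻¹ m * qPoch q A (m + 1) * qPoch q B (m + 1)) /
          (qPoch q q m * qPoch q C m * qPoch q D m) := by
  obtain rfl : D = A * B * q / (C * Q) := by field_simp; linear_combination hD
  induction m with
  | zero =>
    simp [qPoch]
    field_simp
    ring
  | succ m ih =>
    rw [Finset.sum_range_succ, ih (qPoch_ne_zero_of_le m.le_succ h1)
      (qPoch_ne_zero_of_le m.le_succ h2) (qPoch_ne_zero_of_le (m + 1).le_succ h3)]
    rw [qPoch_succ', div_mul_cancel₀ _ hq, qPoch_succ] at h3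
    rw [qPoch_succ] at h1 h2
    rw [qPoch_succ' (Q⁻¹ / q), qPoch_succ' (A * B * q / (C * Q) / q), div_mul_cancel₀ _ hq,
      div_mul_cancel₀ _ hq, qPoch_succ A (m + 1), qPoch_succ B (m + 1), qPoch_succ q,
      qPoch_succ C, qPoch_succ (A * B * q / (C * Q)), qPoch_succ Q⁻¹]
    have h1a := left_ne_zero_of_mul h1
    have h1b := right_ne_zero_of_mul h1
    have h2a := left_ne_zero_of_mul h2
    have h2b := right_ne_zero_of_mul h2
    have h3a := left_ne_zero_of_mul h3
    have h3b := left_ne_zero_of_mul (right_ne_zero_of_mul h3)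
    have h3c := right_ne_zero_of_mul (right_ne_zero_of_mul h3)
    generalize qPoch q q m = X1 at *
    generalize qPoch q C m = X2 at *
    generalize qPoch q (A * B * q / (C * Q)) m = X3 at *
    generalize qPoch q A (m + 1) = X4 at *
    generalize qPoch q B (m + 1) = X5 at *
    generalize qPoch q Q⁻¹ m = X6 at *
    have h3a' : C * Q - A * B ≠ 0 := by
      intro h; apply h3a; field_simp; linear_combination h
    have h3c' : C * Q - A * B * q * q ^ m ≠ 0 := by
      intro h; apply h3c; field_simp; linear_combination h
    field_simp
    ring

/-- The `q`-Pfaff–Saalschütz sum. -/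
theorem qPoch_saalschutz {A B C : ℂ} (hq : q ≠ 0) (hA : A ≠ 0) (hB : B ≠ 0) (hC : C ≠ 0) (j : ℕ) :
    ∀ {D : ℂ}, D * C * q ^ j = A * B * q → qPoch q q j ≠ 0 → qPoch q C j ≠ 0 → qPoch q D j ≠ 0 →
      (∑ k ∈ Finset.range (j + 1), qPoch q (q ^ (-(j : ℤ))) k * qPoch q A k * qPoch q B k * q ^ k /
          (qPoch q q k * qPoch q C k * qPoch q D k)) * (qPoch q C j * qPoch q (C / (A * B)) j)
        = qPoch q (C / A) j * qPoch q (C / B) j := by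
  induction j with
  | zero => simp [qPoch]
  | succ j ih =>
    intro D hD h1 h2 h3
    have hN : q ^ (-((j + 1 : ℕ) : ℤ)) = (q ^ j)⁻¹ / q := by
      rw [zpow_neg, zpow_natCast, pow_succ, mul_inv, div_eq_mul_inv]
    have hN' : q ^ (-(j : ℤ)) = (q ^ j)⁻¹ := by rw [zpow_neg, zpow_natCast]
    have hD' : D * q * C * q ^ j = A * B * q := by rw [← hD]; ring
    have hp := qPoch_saalschutz_partial_sum hq hA hB hC (pow_ne_zero j hq) hD' j
      (qPoch_ne_zero_of_le j.le_succ h1) (qPoch_ne_zero_of_le j.le_succ h2)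
      (by rwa [mul_div_cancel_right₀ _ hq])
    rw [qPoch_succ'] at h3
    have ih' := ih hD' (qPoch_ne_zero_of_le j.le_succ h1) (qPoch_ne_zero_of_le j.le_succ h2)
      (right_ne_zero_of_mul h3)
    rw [mul_div_cancel_right₀ _ hq, Finset.sum_sub_distrib, ← Finset.sum_mul,
      ← Finset.sum_mul] at hp
    rw [hN'] at ih'
    have hlast : qPoch q ((q ^ j)⁻¹ / q) (j + 1) * qPoch q A (j + 1) * qPoch q B (j + 1) *
          q ^ (j + 1) / (qPoch q q (j + 1) * qPoch q C (j + 1) * qPoch q D (j + 1)) *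
          ((1 - C * q ^ j) * (1 - C / (A * B) * q ^ j))
        = C * q ^ j / (A * B) * (qPoch q (q ^ j)⁻¹ j * qPoch q A (j + 1) * qPoch q B (j + 1)) /
          (qPoch q q j * qPoch q C j * qPoch q (D * q) j) := by
      rw [qPoch_succ] at h1 h2
      rw [qPoch_succ' ((q ^ j)⁻¹ / q), qPoch_succ' D, div_mul_cancel₀ _ hq, qPoch_succ q,
        qPoch_succ C]
      have hD0 : D ≠ 0 := by
        rintro rfl
        simp [hA, hB, hq] at hD
      have hE : C / (A * B) * q ^ j = 1 / D := by
        field_simp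
        exact mul_right_cancel₀ hq (by linear_combination hD)
      have hE' : C * q ^ j / (A * B) = 1 / D := by rw [← hE]; ring
      rw [hE, hE']
      have h1a := left_ne_zero_of_mul h1
      have h1b := right_ne_zero_of_mul h1
      have h2a := left_ne_zero_of_mul h2
      have h2b := right_ne_zero_of_mul h2
      have h3a := left_ne_zero_of_mul h3
      have h3b := right_ne_zero_of_mul h3
      generalize qPoch q q j = X1 at *
      generalize qPoch q C j = X2 at *
      generalize qPoch q (D * q) j = X3 at *
      generalize qPoch q A (j + 1) = X4 at *
      generalize qPoch q B (j + 1) = X5 at *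
      generalize qPoch q (q ^ j)⁻¹ j = X6 at *
      have hY := pow_ne_zero j hq
      rw [pow_succ]
      generalize q ^ j = Y at *
      have h1c : 1 - Y * q ≠ 0 := by rwa [mul_comm]
      have h2c : 1 - Y * C ≠ 0 := by rwa [mul_comm]
      field_simp
      ring
    rw [hN, Finset.sum_range_succ, qPoch_succ (C / A), qPoch_succ (C / B),
      qPoch_succ (C / (A * B)), qPoch_succ C j]
    rw [qPoch_succ C j] at hlast
    linear_combination (qPoch q C j * qPoch q (C / (A * B)) j) * (hp + hlast) +
      ((1 - C / A * q ^ j) * (1 - C / B * q ^ j)) * ih'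

/-- Expansion in powers of `x` of a quotient of `q`-shifted factorials, cleared of denominators. -/
theorem sum_qPoch_mul_qPoch_mul_pow (hq : q ≠ 0) {x : ℂ} (hx : x ≠ 0) (n k : ℕ)
    (h : qPoch q q n ≠ 0) :
    qPoch q (q ^ (-(n : ℤ)) * x) k * qPoch q (q / x) k *
        ∑ j ∈ Finset.range (n + 1), qPoch q (q ^ (-(n : ℤ))) j / qPoch q q j *
          (qPoch q (q ^ (-(j : ℤ))) k * qPoch q (q ^ ((j : ℤ) - n)) k) * x ^ j
      = qPoch q (q ^ (-(n : ℤ))) (2 * k) * qPoch q (q ^ (-(n : ℤ)) * x) n := by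
  have hlow : ∀ j < k, qPoch q (q ^ (-(n : ℤ))) j / qPoch q q j *
      (qPoch q (q ^ (-(j : ℤ))) k * qPoch q (q ^ ((j : ℤ) - n)) k) * x ^ j = 0 := by
    intro j hj
    rw [qPoch_zpow_neg_eq_zero hq hj]
    simp
  have hhigh : ∀ j ≤ n, n < j + k → qPoch q (q ^ (-(n : ℤ))) j / qPoch q q j *
      (qPoch q (q ^ (-(j : ℤ))) k * qPoch q (q ^ ((j : ℤ) - n)) k) * x ^ j = 0 := by
    intro j hj hjk
    have : (j : ℤ) - n = -((n - j : ℕ) : ℤ) := by omega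
    rw [this, qPoch_zpow_neg_eq_zero hq (show n - j < k by omega)]
    simp
  rcases lt_or_ge n (2 * k) with hk | hk
  · rw [qPoch_zpow_neg_eq_zero hq hk, Finset.sum_eq_zero, mul_zero, zero_mul]
    intro j hj
    rw [Finset.mem_range] at hj
    rcases lt_or_ge j k with hjk | hjk
    · exact hlow j hjk
    · exact hhigh j (by omega) (by omega)
  · obtain ⟨r, rfl⟩ : ∃ r, n = k + r + k := ⟨n - 2 * k, by omega⟩
    rw [show k + r + k + 1 = k + (r + 1) + k by ring, Finset.sum_range_add, Finset.sum_range_add,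
      Finset.sum_eq_zero (s := Finset.range k) fun j hj => hlow j (Finset.mem_range.1 hj),
      Finset.sum_eq_zero (s := Finset.range k) fun j hj => hhigh _
        (by have := Finset.mem_range.1 hj; omega) (by omega), zero_add, add_zero]
    have hterm : ∀ m ∈ Finset.range (r + 1),
        qPoch q (q ^ (-((k + r + k : ℕ) : ℤ))) (k + m) / qPoch q q (k + m) *
          (qPoch q (q ^ (-((k + m : ℕ) : ℤ))) k *
            qPoch q (q ^ (((k + m : ℕ) : ℤ) - (k + r + k : ℕ))) k) * x ^ (k + m)
        = qPoch q (q ^ (-((k + r + k : ℕ) : ℤ))) (2 * k) * ((-x / q) ^ k / q ^ k.choose 2) *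
          (qPoch q (q ^ (-(r : ℤ))) m / qPoch q q m * (x * (q ^ k)⁻¹) ^ m) := by
      intro m hm
      rw [Finset.mem_range] at hm
      have e1 : qPoch q (q ^ (-((k + r + k : ℕ) : ℤ))) (k + m) *
          qPoch q (q ^ (((k + m : ℕ) : ℤ) - (k + r + k : ℕ))) k
          = qPoch q (q ^ (-((k + r + k : ℕ) : ℤ))) (2 * k) * qPoch q (q ^ (-(r : ℤ))) m := by
        have a1 : q ^ (((k + m : ℕ) : ℤ) - (k + r + k : ℕ))
            = q ^ (-((k + r + k : ℕ) : ℤ)) * q ^ (k + m) := by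
          rw [← zpow_natCast q (k + m), ← zpow_add₀ hq]
          congr 1
          ring
        have a2 : q ^ (-(r : ℤ)) = q ^ (-((k + r + k : ℕ) : ℤ)) * q ^ (2 * k) := by
          rw [← zpow_natCast q (2 * k), ← zpow_add₀ hq]
          congr 1
          push_cast
          ring
        rw [a1, a2, ← qPoch_add, ← qPoch_add]
        congr 1
        ring
      have e2 : qPoch q q (k + m) = qPoch q q m * ((-q ^ (m + 1)) ^ k * q ^ k.choose 2 *
          qPoch q (q ^ (-((k + m : ℕ) : ℤ))) k) := by
        rw [add_comm k m, qPoch_add, ← pow_succ', qPoch_reverse hq (pow_ne_zero (m + 1) hq) k]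
        congr 4
        rw [← zpow_natCast, ← zpow_sub₀ hq]
        congr 1
        push_cast
        ring
      have h1 : qPoch q q (k + m) ≠ 0 := qPoch_ne_zero_of_le (by omega) h
      rw [e2] at h1
      have h1a := left_ne_zero_of_mul h1
      have h1b := right_ne_zero_of_mul (right_ne_zero_of_mul h1)
      calc _ = (qPoch q (q ^ (-((k + r + k : ℕ) : ℤ))) (k + m) *
            qPoch q (q ^ (((k + m : ℕ) : ℤ) - (k + r + k : ℕ))) k) / qPoch q q (k + m) *
            qPoch q (q ^ (-((k + m : ℕ) : ℤ))) k * x ^ (k + m) := by ring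
        _ = _ := by
          rw [e1, e2]
          generalize qPoch q q m = X1 at *
          generalize qPoch q (q ^ (-((k + m : ℕ) : ℤ))) k = X2 at *
          generalize qPoch q (q ^ (-((k + r + k : ℕ) : ℤ))) (2 * k) = X3
          generalize qPoch q (q ^ (-(r : ℤ))) m = X4
          rw [neg_pow, neg_div, neg_pow (x / q), mul_pow, inv_pow, ← pow_mul, div_pow, ← pow_mul]
          have hs : ((-1 : ℂ) ^ k) * (-1) ^ k = 1 := by rw [← mul_pow]; simp
          have hs0 : ((-1 : ℂ) ^ k) ≠ 0 := by simp
          field_simp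
          rw [pow_two, hs]
          ring
    rw [Finset.sum_congr rfl hterm, ← Finset.mul_sum,
      sum_qPoch_div_qPoch_mul_pow hq r _ (qPoch_ne_zero_of_le (by omega) h),
      qPoch_add (q ^ (-((k + r + k : ℕ) : ℤ)) * x) (k + r) k,
      qPoch_add (q ^ (-((k + r + k : ℕ) : ℤ)) * x) k r, qPoch_reverse hq (div_ne_zero hq hx) k]
    have b1 : q ^ (-((k + r + k : ℕ) : ℤ)) * x * q ^ k = q ^ (-(r : ℤ)) * (x * (q ^ k)⁻¹) := by
      rw [show -((k + r + k : ℕ) : ℤ) = -(r : ℤ) - k - k by push_cast; ring, zpow_sub₀ hq,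
        zpow_sub₀ hq, zpow_natCast]
      field_simp
    have b2 : q ^ (-((k + r + k : ℕ) : ℤ)) * x * q ^ (k + r) = q ^ (1 - (k : ℤ)) / (q / x) := by
      rw [show -((k + r + k : ℕ) : ℤ) = -(((k + r : ℕ)) : ℤ) - k by push_cast; ring, zpow_sub₀ hq,
        zpow_neg, zpow_natCast, zpow_natCast, zpow_sub₀ hq, zpow_natCast, zpow_one]
      field_simp
    have b3 : (-(q / x)) ^ k * (-x / q) ^ k = 1 := by
      rw [← mul_pow]
      field_simp
      simp
    rw [b1, b2]
    generalize (-(q / x)) ^ k = U at *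
    generalize (-x / q) ^ k = V at *
    generalize qPoch q (q ^ (1 - (k : ℤ)) / (q / x)) k = X1
    generalize qPoch q (q ^ (-(r : ℤ)) * (x * (q ^ k)⁻¹)) r = X2
    field_simp
    linear_combination (qPoch q (q ^ (-((k + r + k : ℕ) : ℤ)) * x) k * X1 * X2 *
      qPoch q (q ^ (-((k + r + k : ℕ) : ℤ))) (2 * k)) * b3

end QPoch

/-- Sears' ₃φ₂ to ₅φ₄ transformation, terminating case `a = q^{-n}`. -/
theorem sears_3phi2_to_5phi4 (n : ℕ) (q b c x : ℂ) (hq : q ≠ 0) (hb : b ≠ 0) (hc : c ≠ 0)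
    (hx : x ≠ 0)
    (hden : ∀ k ≤ n,
      qPoch q q k * qPoch q (q ^ (1 - (n : ℤ)) / b) k * qPoch q (q ^ (1 - (n : ℤ)) / c) k *
        qPoch q (q ^ (-(n : ℤ)) * x) k * qPoch q (q / x) k ≠ 0) :
    ∑ k ∈ Finset.range (n + 1),
      qPoch q (q ^ (-(n : ℤ))) k * qPoch q b k * qPoch q c k /
        (qPoch q q k * qPoch q (q ^ (1 - (n : ℤ)) / b) k * qPoch q (q ^ (1 - (n : ℤ)) / c) k) *
        (q ^ (1 - (n : ℤ)) * x / (b * c)) ^ k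
    = qPoch q (q ^ (-(n : ℤ)) * x) n *
        ∑ k ∈ Finset.range (n + 1),
          qPoch q (q ^ (-(n : ℤ))) (2 * k) * qPoch q (q ^ (1 - (n : ℤ)) / (b * c)) k * q ^ k /
            (qPoch q q k * qPoch q (q ^ (1 - (n : ℤ)) / b) k * qPoch q (q ^ (1 - (n : ℤ)) / c) k *
              qPoch q (q ^ (-(n : ℤ)) * x) k * qPoch q (q / x) k) := by
  have hd := hden n le_rfl
  have hqn : qPoch q q n ≠ 0 := fun h => hd (by simp [h])
  have hbn : qPoch q (q ^ (1 - (n : ℤ)) / b) n ≠ 0 := fun h => hd (by simp [h])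
  have hcn : qPoch q (q ^ (1 - (n : ℤ)) / c) n ≠ 0 := fun h => hd (by simp [h])
  have hz : ∀ m : ℤ, q ^ m ≠ 0 := fun m => zpow_ne_zero m hq
  have hterm : ∀ k ∈ Finset.range (n + 1),
      qPoch q (q ^ (-(n : ℤ)) * x) n *
        (qPoch q (q ^ (-(n : ℤ))) (2 * k) * qPoch q (q ^ (1 - (n : ℤ)) / (b * c)) k * q ^ k /
            (qPoch q q k * qPoch q (q ^ (1 - (n : ℤ)) / b) k * qPoch q (q ^ (1 - (n : ℤ)) / c) k *
              qPoch q (q ^ (-(n : ℤ)) * x) k * qPoch q (q / x) k))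
      = ∑ j ∈ Finset.range (n + 1), qPoch q (q ^ (-(n : ℤ))) j / qPoch q q j * x ^ j *
          (qPoch q (q ^ (-(j : ℤ))) k * qPoch q (q ^ ((j : ℤ) - n)) k *
            qPoch q (q ^ (1 - (n : ℤ)) / (b * c)) k * q ^ k /
            (qPoch q q k * qPoch q (q ^ (1 - (n : ℤ)) / b) k *
              qPoch q (q ^ (1 - (n : ℤ)) / c) k)) := by
    intro k hk
    have hdk := hden k (Nat.lt_succ_iff.1 (Finset.mem_range.1 hk))
    have h5 := right_ne_zero_of_mul hdk
    have h4 := right_ne_zero_of_mul (left_ne_zero_of_mul hdk)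
    have h3 := left_ne_zero_of_mul (left_ne_zero_of_mul hdk)
    have hsum := sum_qPoch_mul_qPoch_mul_pow hq hx n k hqn
    have hpull : ∑ j ∈ Finset.range (n + 1), qPoch q (q ^ (-(n : ℤ))) j / qPoch q q j * x ^ j *
          (qPoch q (q ^ (-(j : ℤ))) k * qPoch q (q ^ ((j : ℤ) - n)) k *
            qPoch q (q ^ (1 - (n : ℤ)) / (b * c)) k * q ^ k /
            (qPoch q q k * qPoch q (q ^ (1 - (n : ℤ)) / b) k *
              qPoch q (q ^ (1 - (n : ℤ)) / c) k))
        = (∑ j ∈ Finset.range (n + 1), qPoch q (q ^ (-(n : ℤ))) j / qPoch q q j *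
          (qPoch q (q ^ (-(j : ℤ))) k * qPoch q (q ^ ((j : ℤ) - n)) k) * x ^ j) *
          (qPoch q (q ^ (1 - (n : ℤ)) / (b * c)) k * q ^ k / (qPoch q q k *
            qPoch q (q ^ (1 - (n : ℤ)) / b) k * qPoch q (q ^ (1 - (n : ℤ)) / c) k)) := by
      rw [Finset.sum_mul]
      exact Finset.sum_congr rfl fun j _ => by ring
    rw [hpull, mul_assoc _ (qPoch q (q ^ (-(n : ℤ)) * x) k), ← mul_div_assoc,
      div_eq_iff (mul_ne_zero h3 (mul_ne_zero h4 h5))]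
    rw [mul_assoc (qPoch q (q ^ (-(n : ℤ))) (2 * k)), ← mul_assoc (qPoch q _ n),
      mul_comm (qPoch q _ n), ← hsum]
    generalize qPoch q q k * qPoch q (q ^ (1 - (n : ℤ)) / b) k *
      qPoch q (q ^ (1 - (n : ℤ)) / c) k = X at h3 ⊢
    field_simp
  rw [Finset.mul_sum, Finset.sum_congr rfl hterm, Finset.sum_comm]
  refine Finset.sum_congr rfl fun j hj => ?_
  have hjn : j ≤ n := Nat.lt_succ_iff.1 (Finset.mem_range.1 hj)
  obtain ⟨r, rfl⟩ := Nat.exists_eq_add_of_le hjn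
  rw [← Finset.mul_sum, show j + r + 1 = j + 1 + r by ring, Finset.sum_range_add,
    Finset.sum_eq_zero (s := Finset.range r), add_zero]
  swap
  · intro i _
    rw [qPoch_zpow_neg_eq_zero hq (show j < j + 1 + i by omega)]
    simp
  have hqj := qPoch_ne_zero_of_le hjn hqn
  have hbj := qPoch_ne_zero_of_le hjn hbn
  have hcj := qPoch_ne_zero_of_le hjn hcn
  have hS := qPoch_saalschutz (A := q ^ ((j : ℤ) - (j + r : ℕ)))
    (B := q ^ (1 - ((j + r : ℕ) : ℤ)) / (b * c)) (C := q ^ (1 - ((j + r : ℕ) : ℤ)) / b)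
    (D := q ^ (1 - ((j + r : ℕ) : ℤ)) / c) hq (hz _) (div_ne_zero (hz _) (mul_ne_zero hb hc))
    (div_ne_zero (hz _) hb) j
    (by
      push_cast
      rw [zpow_sub₀ hq, zpow_sub₀ hq, zpow_add₀ hq, zpow_natCast, zpow_natCast, zpow_one]
      field_simp) hqj hbj hcj
  have e1 : q ^ (1 - ((j + r : ℕ) : ℤ)) / b / q ^ ((j : ℤ) - (j + r : ℕ))
      = q ^ (1 - (j : ℤ)) / b := by
    push_cast
    rw [zpow_sub₀ hq, zpow_sub₀ hq, zpow_sub₀ hq, zpow_add₀ hq]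
    field_simp
  have e2 : q ^ (1 - ((j + r : ℕ) : ℤ)) / b / (q ^ (1 - ((j + r : ℕ) : ℤ)) / (b * c)) = c := by
    have := hz (1 - ((j + r : ℕ) : ℤ))
    field_simp
  have e3 : q ^ (1 - ((j + r : ℕ) : ℤ)) / b /
      (q ^ ((j : ℤ) - (j + r : ℕ)) * (q ^ (1 - ((j + r : ℕ) : ℤ)) / (b * c)))
      = q ^ (1 - (j : ℤ)) / (q ^ (1 - ((j + r : ℕ) : ℤ)) / c) := by
    push_cast
    rw [zpow_sub₀ hq, zpow_sub₀ hq, zpow_sub₀ hq, zpow_add₀ hq]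
    field_simp
  rw [e1, e2, e3] at hS
  have r1 := qPoch_reverse hq hb j
  have r2 := qPoch_reverse hq (div_ne_zero (hz (1 - ((j + r : ℕ) : ℤ))) hc) j
  have hE : qPoch q (q ^ (1 - (j : ℤ)) / (q ^ (1 - ((j + r : ℕ) : ℤ)) / c)) j ≠ 0 := by
    intro h
    rw [h, mul_zero] at r2
    exact hcj r2
  rw [eq_div_of_mul_eq (mul_ne_zero hbj hE) hS, r1, r2]
  have hqp := hz (1 - ((j + r : ℕ) : ℤ))
  generalize q ^ (1 - ((j + r : ℕ) : ℤ)) = P at *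
  generalize qPoch q (q ^ (1 - (j : ℤ)) / (P / c)) j = X1 at *
  generalize qPoch q (P / b) j = X2 at *
  have hpow : (-b) ^ j * (P * x / (b * c)) ^ j = (-(P / c)) ^ j * x ^ j := by
    rw [← mul_pow, ← mul_pow]
    congr 1
    field_simp
  have hne : (-(P / c)) ^ j ≠ 0 := pow_ne_zero _ (neg_ne_zero.2 (div_ne_zero hqp hc))
  generalize (-(P / c)) ^ j = U at *
  generalize (P * x / (b * c)) ^ j = V at *
  generalize (-b) ^ j = W at *
  field_simp
  linear_combination (qPoch q (q ^ (-((j + r : ℕ) : ℤ))) j * qPoch q (q ^ (1 - (j : ℤ)) / b) j *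
    qPoch q c j) * hpow
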